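/- Under the pre-treatment factor model and the post-treatment surrogate factor model with weights Γα = β and Φγ = θ, the mean of the treated potential outcome is identified by donors and surrogates jointly: E[Y1] = E[⟪W, α⟫ + ⟪X, γ⟫]. -/

import Mathlib

open MeasureTheory Matrix

theorem integral_eq_zero_of_condExp_ae_eq_zero {Ω : Type*} {m m₀ : MeasurableSpace Ω}
    {P : Measure Ω} [IsFiniteMeasure P] (hm : m ≤ m₀) {f : Ω → ℝ} (hf : P[f | m] =ᵐ[P] 0) :
    ∫ ω, f ω ∂P = 0 := by
  rw [← integral_condExp hm, integral_congr_ae hf]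
  simp

theorem integrable_dotProduct_const {Ω ι : Type*} [Fintype ι] [MeasurableSpace Ω]
    {P : Measure Ω} {f : Ω → ι → ℝ} (hf : ∀ i, Integrable (fun ω => f ω i) P) (c : ι → ℝ) :
    Integrable (fun ω => f ω ⬝ᵥ c) P :=
  integrable_finsetSum _ fun i _ => (hf i).mul_const (c i)

theorem integral_dotProduct_const {Ω ι : Type*} [Fintype ι] [MeasurableSpace Ω]
    {P : Measure Ω} {f : Ω → ι → ℝ} (hf : ∀ i, Integrable (fun ω => f ω i) P) (c : ι → ℝ) :
    ∫ ω, f ω ⬝ᵥ c ∂P = (fun i => ∫ ω, f ω i ∂P) ⬝ᵥ c := by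
  simp only [dotProduct]
  rw [integral_finsetSum _ fun i _ => (hf i).mul_const (c i)]
  simp only [integral_mul_const]

theorem transpose_mulVec_dotProduct {m n : Type*} [Fintype m] [Fintype n]
    (A : Matrix m n ℝ) (v : m → ℝ) (w : n → ℝ) :
    A.transpose.mulVec v ⬝ᵥ w = v ⬝ᵥ A.mulVec w := by
  rw [mulVec_transpose, dotProduct_mulVec]

/-- Under the pre-treatment factor model and the post-treatment surrogate factor
model with weights Γα = β and Φγ = θ, the mean of the treated potential outcome is identified
by donors and surrogates jointly: E[Y1] = E[⟪W, α⟫ + ⟪X, γ⟫]. -/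
theorem sc_identification_Y1
    {Ω : Type*} [MeasurableSpace Ω] (P : Measure Ω) [IsProbabilityMeasure P]
    {F N K H : ℕ}
    (lam : Ω → Fin F → ℝ) (β : Fin F → ℝ) (Γ : Matrix (Fin F) (Fin N) ℝ)
    (rho : Ω → Fin K → ℝ) (θ : Fin K → ℝ) (Φ : Matrix (Fin K) (Fin H) ℝ)
    (Y0 Y1 : Ω → ℝ) (W : Ω → Fin N → ℝ) (X : Ω → Fin H → ℝ)
    (εY : Ω → ℝ) (εW : Ω → Fin N → ℝ) (δ : Ω → ℝ) (εX : Ω → Fin H → ℝ)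
    (hlam : Measurable lam) (hrho : Measurable rho)
    (hY0 : ∀ ω, Y0 ω = lam ω ⬝ᵥ β + εY ω)
    (hW : ∀ ω, W ω = Γ.transpose.mulVec (lam ω) + εW ω)
    (hY1 : ∀ ω, Y1 ω - Y0 ω = rho ω ⬝ᵥ θ + δ ω)
    (hX : ∀ ω, X ω = Φ.transpose.mulVec (rho ω) + εX ω)
    (hεY : P[εY | MeasurableSpace.comap (fun ω => (lam ω, rho ω)) inferInstance] =ᵐ[P] 0)
    (hεW : ∀ i, P[(fun ω => εW ω i) |
      MeasurableSpace.comap (fun ω => (lam ω, rho ω)) inferInstance] =ᵐ[P] 0)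
    (hδ : P[δ | MeasurableSpace.comap (fun ω => (lam ω, rho ω)) inferInstance] =ᵐ[P] 0)
    (hεX : ∀ i, P[(fun ω => εX ω i) |
      MeasurableSpace.comap (fun ω => (lam ω, rho ω)) inferInstance] =ᵐ[P] 0)
    (hY0int : Integrable Y0 P) (hY1int : Integrable Y1 P)
    (hεYint : Integrable εY P) (hδint : Integrable δ P)
    (hlamint : ∀ i, Integrable (fun ω => lam ω i) P)
    (hrhoint : ∀ i, Integrable (fun ω => rho ω i) P)
    (hWint : ∀ i, Integrable (fun ω => W ω i) P)
    (hXint : ∀ i, Integrable (fun ω => X ω i) P)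
    (hεWint : ∀ i, Integrable (fun ω => εW ω i) P)
    (hεXint : ∀ i, Integrable (fun ω => εX ω i) P)
    (α : Fin N → ℝ) (hα : Γ.mulVec α = β)
    (γ : Fin H → ℝ) (hγ : Φ.mulVec γ = θ) :
    ∫ ω, Y1 ω ∂P = ∫ ω, (W ω ⬝ᵥ α + X ω ⬝ᵥ γ) ∂P := by
  have hm : MeasurableSpace.comap (fun ω => (lam ω, rho ω)) inferInstance ≤ ‹MeasurableSpace Ω› :=
    (hlam.prodMk hrho).comap_le
  have hY : ∀ ω, Y1 ω = lam ω ⬝ᵥ β + rho ω ⬝ᵥ θ + εY ω + δ ω := fun ω => by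
    linarith [hY0 ω, hY1 ω]
  have hWX : ∀ ω, W ω ⬝ᵥ α + X ω ⬝ᵥ γ =
      lam ω ⬝ᵥ β + rho ω ⬝ᵥ θ + εW ω ⬝ᵥ α + εX ω ⬝ᵥ γ := fun ω => by
    rw [hW, hX, add_dotProduct, add_dotProduct, transpose_mulVec_dotProduct,
      transpose_mulVec_dotProduct, hα, hγ]
    ring
  have hfactor : Integrable (fun ω => lam ω ⬝ᵥ β + rho ω ⬝ᵥ θ) P :=
    (integrable_dotProduct_const hlamint β).add (integrable_dotProduct_const hrhoint θ)
  have hεWα := integrable_dotProduct_const hεWint α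
  have hεXγ := integrable_dotProduct_const hεXint γ
  simp only [hY, hWX]
  rw [integral_add (hfactor.fun_add hεYint) hδint, integral_add hfactor hεYint,
    integral_add (hfactor.fun_add hεWα) hεXγ, integral_add hfactor hεWα,
    integral_dotProduct_const hεWint, integral_dotProduct_const hεXint,
    integral_eq_zero_of_condExp_ae_eq_zero hm hεY, integral_eq_zero_of_condExp_ae_eq_zero hm hδ]
  simp [dotProduct, fun i => integral_eq_zero_of_condExp_ae_eq_zero hm (hεW i),
    fun i => integral_eq_zero_of_condExp_ae_eq_zero hm (hεX i)]
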